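/- Suppose Condition (C) holds for equation (28). Then equation (28) has at most m isolated periodic solutions; precisely, the set of real numbers x_0 such that the solution of (28) with initial value x(0) = x_0 is a periodic solution and is isolated has at most m elements. -/

import Mathlib

open Set

/-- `x` is a periodic solution of `dx/dt = S(x,t)` on `[0,1]`. -/
def IsPeriodicSol (S : ℝ → ℝ → ℝ) (x : ℝ → ℝ) : Prop :=
  (∀ t ∈ Set.Icc (0:ℝ) 1, HasDerivWithinAt x (S (x t) t) (Set.Icc (0:ℝ) 1) t) ∧ x 0 = x 1

/-- An isolated periodic solution. -/
def IsIsolatedPeriodicSol (S : ℝ → ℝ → ℝ) (x : ℝ → ℝ) : Prop :=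
  IsPeriodicSol S x ∧
    ∃ ε > 0, ∀ y : ℝ → ℝ, IsPeriodicSol S y → |y 0 - x 0| < ε → y 0 = x 0

/-- Condition (C). -/
def CondC (m : ℕ) (fa fb fc : ℝ → ℝ) : Prop :=
  ∃ κ : ℕ → ℝ,
    (∀ i j, 1 ≤ i → i < j → j ≤ m → κ i < κ j) ∧
    (∀ i, 1 ≤ i → i ≤ m → fa (κ i) ^ 2 - fb (κ i) ^ 2 - fc (κ i) ^ 2 = 0) ∧
    ((∀ i, 1 ≤ i → i ≤ m → 0 ≤ (-1:ℝ) ^ i * fa (κ i)) ∨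
     (∀ i, 1 ≤ i → i ≤ m → (-1:ℝ) ^ i * fa (κ i) ≤ 0))


/-- A periodic solution of a linear equation with a nonnegative source that vanishes somewhere
starts at zero, and the source is zero. -/
lemma eq_zero_of_periodic_linear {u p g : ℝ → ℝ} (hg : ContinuousOn g (Icc 0 1))
    (hp : ∀ t ∈ Icc (0:ℝ) 1, 0 ≤ p t)
    (hu : ∀ t ∈ Icc (0:ℝ) 1, HasDerivWithinAt u (p t + g t * u t) (Icc 0 1) t)
    (hper : u 0 = u 1) {t₀ : ℝ} (ht₀ : t₀ ∈ Icc (0:ℝ) 1) (h₀ : u t₀ = 0) :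
    u 0 = 0 ∧ ∀ t ∈ Icc (0:ℝ) 1, p t = 0 := by
  have h01 : (0:ℝ) ≤ 1 := zero_le_one
  set G : ℝ → ℝ := IccExtend h01 ((Icc (0:ℝ) 1).domRestrict g) with hGdef
  have hG : Continuous G := hg.domRestrict.Icc_extend'
  have hGg : ∀ t ∈ Icc (0:ℝ) 1, G t = g t := fun t ht => by
    rw [hGdef, IccExtend_of_mem _ _ ht]; rfl
  set I : ℝ → ℝ := fun t => ∫ s in (0:ℝ)..t, G s
  have hI : ∀ t, HasDerivAt I (G t) t := fun t =>
    intervalIntegral.integral_hasDerivAt_right (hG.intervalIntegrable _ _)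
      (hG.stronglyMeasurableAtFilter _ _) hG.continuousAt
  set w : ℝ → ℝ := fun t => u t * Real.exp (-I t)
  have hw : ∀ t ∈ Icc (0:ℝ) 1,
      HasDerivWithinAt w (p t * Real.exp (-I t)) (Icc 0 1) t := fun t ht => by
    have := (hu t ht).mul (((hI t).neg.exp).hasDerivWithinAt (s := Icc (0:ℝ) 1))
    refine this.congr_deriv ?_
    rw [hGg t ht, Pi.neg_apply]; ring
  have hmono : MonotoneOn w (Icc 0 1) := by
    refine monotoneOn_of_deriv_nonneg (convex_Icc _ _)
      (fun t ht => (hw t ht).continuousWithinAt)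
      (fun t ht => ?_) (fun t ht => ?_)
    · exact (hw t (interior_subset ht)).differentiableWithinAt.mono interior_subset
    · have := (hw t (interior_subset ht)).hasDerivAt (mem_interior_iff_mem_nhds.1 ht)
      rw [this.deriv]
      exact mul_nonneg (hp t (interior_subset ht)) (Real.exp_pos _).le
  have hz : (0:ℝ) ∈ Icc (0:ℝ) 1 := ⟨le_rfl, h01⟩
  have ho : (1:ℝ) ∈ Icc (0:ℝ) 1 := ⟨h01, le_rfl⟩
  have hwt₀ : w t₀ = 0 := by simp [w, h₀]
  have h0 : u 0 ≤ 0 := by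
    have := hmono hz ht₀ ht₀.1
    rw [hwt₀] at this
    exact nonpos_of_mul_nonpos_left this (Real.exp_pos _)
  have h1 : 0 ≤ u 1 := by
    have := hmono ht₀ ho ht₀.2
    rw [hwt₀] at this
    exact nonneg_of_mul_nonneg_left this (Real.exp_pos _)
  have hu0 : u 0 = 0 := le_antisymm h0 (hper ▸ h1)
  have hw0 : w 0 = 0 := by simp [w, hu0]
  have hw1 : w 1 = 0 := by simp [w, ← hper, hu0]
  refine ⟨hu0, fun t ht => ?_⟩
  have hconst : ∀ s ∈ Icc (0:ℝ) 1, w s = 0 := fun s hs =>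
    le_antisymm (hw1 ▸ hmono hs ho hs.2) (hw0 ▸ hmono hz hs hs.1)
  have hd : HasDerivWithinAt w 0 (Icc 0 1) t :=
    (hasDerivWithinAt_const t _ (0:ℝ)).congr hconst (hconst t ht)
  have := (uniqueDiffOn_Icc zero_lt_one t ht).eq_deriv _ (hw t ht) hd
  exact (mul_eq_zero.1 this).resolve_right (Real.exp_pos _).ne'

lemma mul_pos_of_continuousOn_ne_zero {z : ℝ → ℝ} (hz : ContinuousOn z (Icc 0 1))
    (h : ∀ t ∈ Icc (0:ℝ) 1, z t ≠ 0) {t : ℝ} (ht : t ∈ Icc (0:ℝ) 1) : 0 < z 0 * z t := by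
  by_contra! hneg
  have hsub : uIcc 0 t ⊆ Icc (0:ℝ) 1 := by
    rw [uIcc_of_le ht.1]; exact Icc_subset_Icc le_rfl ht.2
  have h0 : (0:ℝ) ∈ uIcc (z 0) (z t) := by
    rw [mem_uIcc]
    rcases mul_nonpos_iff.1 hneg with h | h
    · exact Or.inr ⟨h.2, h.1⟩
    · exact Or.inl h
  obtain ⟨s, hs, hzs⟩ := intermediate_value_uIcc (hz.mono hsub) h0
  exact h s (hsub hs) hzs

lemma IsPeriodicSol.continuousOn {S : ℝ → ℝ → ℝ} {x : ℝ → ℝ} (hx : IsPeriodicSol S x) :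
    ContinuousOn x (Icc 0 1) := fun t ht => (hx.1 t ht).continuousWithinAt

/-- A periodic solution touching a periodic sub- or supersolution starts at the same point,
and the latter is a solution. -/
lemma IsPeriodicSol.eq_of_touch {m : ℕ} {d : ℕ → ℝ → ℝ} (hd : ∀ i, Continuous (d i))
    {S : ℝ → ℝ → ℝ} (hS : ∀ x t, S x t = ∑ i ∈ Finset.range (m + 1), d i t * x ^ i)
    {x y q : ℝ → ℝ} (hx : IsPeriodicSol S x)
    (hy : ∀ t ∈ Icc (0:ℝ) 1, HasDerivWithinAt y (q t) (Icc 0 1) t) (hy01 : y 0 = y 1)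
    {σ : ℝ} (hσ : σ ≠ 0) (hq : ∀ t ∈ Icc (0:ℝ) 1, 0 ≤ σ * (S (y t) t - q t))
    {t₀ : ℝ} (ht₀ : t₀ ∈ Icc (0:ℝ) 1) (h₀ : x t₀ = y t₀) :
    x 0 = y 0 ∧ ∀ t ∈ Icc (0:ℝ) 1, S (y t) t = q t := by
  have hyc : ContinuousOn y (Icc 0 1) := fun t ht => (hy t ht).continuousWithinAt
  set g : ℝ → ℝ := fun t => ∑ i ∈ Finset.range (m + 1),
    d i t * ∑ j ∈ Finset.range i, x t ^ j * y t ^ (i - 1 - j) with hg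
  have hgS : ∀ t, S (x t) t - S (y t) t = g t * (x t - y t) := fun t => by
    rw [hS, hS, hg, Finset.sum_mul, ← Finset.sum_sub_distrib]
    refine Finset.sum_congr rfl fun i _ => ?_
    rw [mul_assoc, (Commute.all (x t) (y t)).geom_sum₂_mul]; ring
  have hgc : ContinuousOn g (Icc 0 1) := by
    refine continuousOn_finsetSum _ fun i _ => (hd i).continuousOn.mul ?_
    exact continuousOn_finsetSum _ fun j _ => (hx.continuousOn.pow _).mul (hyc.pow _)
  obtain ⟨h1, h2⟩ := eq_zero_of_periodic_linear (u := fun t => σ * (x t - y t)) hgc hq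
    (fun t ht => (((hx.1 t ht).sub (hy t ht)).const_mul σ).congr_deriv (by
      linear_combination σ * hgS t))
    (by simp only [hx.2, hy01]) ht₀ (by simp [h₀])
  refine ⟨sub_eq_zero.1 ((mul_eq_zero.1 h1).resolve_left hσ), fun t ht => ?_⟩
  exact sub_eq_zero.1 ((mul_eq_zero.1 (h2 t ht)).resolve_left hσ)

open Polynomial in
/-- Lagrange form of a polynomial of degree at most the number of nodes. -/
lemma sum_eq_nodal_mul {m : ℕ} {κ : ℕ → ℝ} (hκ : Set.InjOn κ (Finset.Icc 1 m))
    (e : ℕ → ℝ) {x : ℝ} (hx : ∀ i ∈ Finset.Icc 1 m, x ≠ κ i) :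
    ∑ i ∈ Finset.range (m + 1), e i * x ^ i =
      (Lagrange.nodal (Finset.Icc 1 m) κ).eval x *
        (e m + ∑ i ∈ Finset.Icc 1 m, Lagrange.nodalWeight (Finset.Icc 1 m) κ i *
          (x - κ i)⁻¹ * ∑ j ∈ Finset.range (m + 1), e j * κ i ^ j) := by
  set s := Finset.Icc 1 m with hs
  have hcard : s.card = m := by simp [hs]
  set N := Lagrange.nodal s κ
  set Q : ℝ[X] := ∑ i ∈ Finset.range (m + 1), C (e i) * X ^ i
  have hQ : ∀ z, Q.eval z = ∑ i ∈ Finset.range (m + 1), e i * z ^ i := fun z => by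
    simp [Q, eval_finsetSum]
  have hdeg : (Q - C (e m) * N).degree < s.card := by
    have h1 : (Q - C (e m) * N) = (∑ i ∈ Finset.range m, C (e i) * X ^ i)
        - C (e m) * (N - X ^ m) := by
      simp only [Q, Finset.sum_range_succ]; ring
    rw [h1, hcard]
    have hX : (N - X ^ m).degree < (m : WithBot ℕ) := by
      have hN : N.degree = m := by rw [Lagrange.degree_nodal, hcard]
      have := degree_sub_lt_left (p := N) (q := X ^ m) (by rw [hN, degree_X_pow])
        Lagrange.nodal_ne_zero (by rw [Lagrange.nodal_monic.leadingCoeff, leadingCoeff_X_pow])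
      rwa [hN] at this
    refine (degree_sub_le _ _).trans_lt (max_lt ?_ ?_)
    · refine (degree_sum_le _ _).trans_lt ?_
      refine (Finset.sup_lt_iff (WithBot.bot_lt_coe m)).2 ?_
      exact fun i hi => (degree_C_mul_X_pow_le _ _).trans_lt
        (WithBot.coe_lt_coe.2 (Finset.mem_range.1 hi))
    · exact (by rw [← smul_eq_C_mul]; exact degree_smul_le _ _ : _ ≤ (N - X ^ m).degree).trans_lt hX
  have hint := Lagrange.eq_interpolate_of_eval_eq (r := fun i => Q.eval (κ i)) hκ hdeg
    (fun i hi => by simp [N, Lagrange.eval_nodal_at_node hi])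
  have := congrArg (Polynomial.eval x) hint
  have h2 := Lagrange.eval_interpolate_not_at_node (fun i => Q.eval (κ i)) hx
  rw [h2] at this
  simp only [eval_sub, eval_mul, eval_C, hQ] at this
  linear_combination this

lemma nodalWeight_sign {m : ℕ} {κ : ℕ → ℝ}
    (hκ : ∀ i j, 1 ≤ i → i < j → j ≤ m → κ i < κ j) {i : ℕ} (hi : i ∈ Finset.Icc 1 m) :
    0 < (-1:ℝ) ^ m * (-1:ℝ) ^ i * Lagrange.nodalWeight (Finset.Icc 1 m) κ i := by
  rw [Finset.mem_Icc] at hi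
  have hcard : ∏ j ∈ (Finset.Icc 1 m).erase i, (if i < j then (-1:ℝ) else 1) =
      (-1) ^ (m - i) := by
    rw [Finset.prod_ite, Finset.prod_const, Finset.prod_const_one, mul_one]
    congr 1
    have : ((Finset.Icc 1 m).erase i).filter (fun j => i < j) = Finset.Ioc i m := by
      ext j; simp only [Finset.mem_filter, Finset.mem_erase, Finset.mem_Icc, Finset.mem_Ioc]
      omega
    rw [this, Nat.card_Ioc]
  have hpow : (-1:ℝ) ^ m * (-1:ℝ) ^ i = (-1) ^ (m - i) := by
    obtain ⟨k, rfl⟩ := Nat.exists_eq_add_of_le hi.2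
    rw [Nat.add_sub_cancel_left, pow_add, mul_right_comm, ← mul_pow]; simp
  rw [hpow, ← hcard, Lagrange.nodalWeight, ← Finset.prod_mul_distrib]
  refine Finset.prod_pos fun j hj => ?_
  rw [Finset.mem_erase, Finset.mem_Icc] at hj
  split_ifs with h
  · have : (κ i - κ j)⁻¹ < 0 := inv_lt_zero.2 (sub_neg.2 (hκ i j hi.1 h hj.2.2))
    linarith
  · rw [one_mul]
    exact inv_pos.2 (sub_pos.2 (hκ j i hj.2.1 (by omega) hi.2))

open scoped NNReal in
/-- A separable equation whose time factor has zero mean has no isolated periodic solution. -/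
lemma not_isIsolatedPeriodicSol_of_separable {S : ℝ → ℝ → ℝ} {P l Λ : ℝ → ℝ}
    (hP : ContDiff ℝ 1 P) (hl : Continuous l) (hΛ : ∀ t, HasDerivAt Λ (l t) t)
    (h0 : Λ 0 = 0) (h1 : Λ 1 = 0) (hS : ∀ x t, S x t = l t * P x) (x : ℝ → ℝ) :
    ¬ IsIsolatedPeriodicSol S x := by
  rintro ⟨hx, ε, hε, hiso⟩
  obtain ⟨B, hB⟩ := isCompact_Icc.exists_bound_of_continuousOn hx.continuousOn
  have hB0 : 0 ≤ B := (norm_nonneg _).trans (hB 0 (left_mem_Icc.2 zero_le_one))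
  have hBB : -(B + 1) ≤ B + 1 := by linarith
  obtain ⟨K, hK⟩ := hP.contDiffOn.exists_lipschitzOnWith one_ne_zero
    (convex_Icc (-(B + 1)) (B + 1)) isCompact_Icc
  set Q : ℝ → ℝ := fun z => P (projIcc (-(B + 1)) (B + 1) hBB z) with hQdef
  have hQP : ∀ z, |z| ≤ B + 1 → Q z = P z := fun z hz => by
    rw [hQdef]; simp only [projIcc_of_mem hBB (abs_le.1 hz)]
  have hQK : LipschitzWith K Q := by
    have := (lipschitzOnWith_iff_restrict.1 hK).comp (LipschitzWith.projIcc hBB)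
    rwa [mul_one] at this
  obtain ⟨M, hM⟩ := isCompact_Icc.exists_bound_of_continuousOn
    (hP.continuous.continuousOn (s := Icc (-(B + 1)) (B + 1)))
  have hQM : ∀ z, ‖Q z‖ ≤ M := fun z => hM _ (projIcc _ _ hBB z).2
  have hM0 : 0 ≤ M := (norm_nonneg _).trans (hQM 0)
  have hΛc : Continuous Λ := continuous_iff_continuousAt.2 fun t => (hΛ t).continuousAt
  obtain ⟨T, hT⟩ := isCompact_Icc.exists_bound_of_continuousOn
    (hΛc.continuousOn (s := Icc (0:ℝ) 1))
  have hT0 : 0 ≤ T := (norm_nonneg _).trans (hT 0 (left_mem_Icc.2 zero_le_one))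
  obtain ⟨C, hC⟩ := isCompact_Icc.exists_bound_of_continuousOn
    (hl.continuousOn (s := Icc (0:ℝ) 1))
  have hC0 : 0 ≤ C := (norm_nonneg _).trans (hC 0 (left_mem_Icc.2 zero_le_one))
  set D : ℝ := C * K
  set δ : ℝ := min (ε / 2) (Real.exp (-D))
  have hδ : 0 < δ := lt_min (by linarith) (Real.exp_pos _)
  have hT' : (0:ℝ) ∈ Icc (-T) T := ⟨by linarith, hT0⟩
  have hpl : IsPicardLindelof (fun _ => Q) (⟨0, hT'⟩ : Icc (-T) T) (x 0 + δ)
      (NNReal.mk M hM0 * NNReal.mk T hT0) 0 (NNReal.mk M hM0) K := by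
    refine IsPicardLindelof.of_time_independent (fun z _ => hQM z) hQK.lipschitzOnWith ?_
    simp
  obtain ⟨v, hv0, hv⟩ := hpl.exists_eq_forall_mem_Icc_hasDerivWithinAt₀
  have hmaps : MapsTo Λ (Icc 0 1) (Icc (-T) T) := fun t ht => abs_le.1 (hT t ht)
  set y : ℝ → ℝ := fun t => v (Λ t)
  have hy : ∀ t ∈ Icc (0:ℝ) 1, HasDerivWithinAt y (l t * Q (y t)) (Icc 0 1) t := fun t ht => by
    have := (hv (Λ t) (hmaps ht)).comp t (hΛ t).hasDerivWithinAt hmaps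
    exact this.congr_deriv (mul_comm _ _)
  have hxQ : ∀ t ∈ Icc (0:ℝ) 1, HasDerivWithinAt x (l t * Q (x t)) (Icc 0 1) t := fun t ht => by
    rw [hQP _ ((hB t ht).trans (by linarith)), ← hS]; exact hx.1 t ht
  have hy0 : y 0 = x 0 + δ := by simp only [y, h0]; exact hv0
  have hy1 : y 1 = x 0 + δ := by simp only [y, h1]; exact hv0
  have hici : ∀ {f : ℝ → ℝ} {f' t : ℝ}, t ∈ Ico (0:ℝ) 1 →
      HasDerivWithinAt f f' (Icc 0 1) t → HasDerivWithinAt f f' (Ici t) t := fun ht h =>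
    h.mono_of_mem_nhdsWithin (Filter.mem_of_superset (Icc_mem_nhdsGE ht.2)
      (Icc_subset_Icc ht.1 le_rfl))
  have hgron := dist_le_of_trajectories_ODE_of_mem (v := fun t z => l t * Q z)
    (s := fun _ => univ) (K := NNReal.mk C hC0 * K) (f := y) (g := x) (a := 0) (b := 1) (δ := δ)
    (fun t ht => by
      refine LipschitzOnWith.of_dist_le_mul fun z _ z' _ => ?_
      rw [Real.dist_eq, ← mul_sub, abs_mul, NNReal.coe_mul, mul_assoc]
      exact mul_le_mul (hC t (Ico_subset_Icc_self ht)) (hQK.dist_le_mul z z') (abs_nonneg _) hC0)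
    (fun t ht => (hy t ht).continuousWithinAt)
    (fun t ht => hici ht (hy t (Ico_subset_Icc_self ht))) (fun _ _ => mem_univ _)
    hx.continuousOn
    (fun t ht => hici ht (hxQ t (Ico_subset_Icc_self ht))) (fun _ _ => mem_univ _)
    (by rw [hy0, Real.dist_eq, add_sub_cancel_left, abs_of_pos hδ])
  have hyB : ∀ t ∈ Icc (0:ℝ) 1, |y t| ≤ B + 1 := fun t ht => by
    have h2 : dist (y t) (x t) ≤ 1 := by
      refine (hgron t ht).trans ?_
      have hD0 : 0 ≤ D := mul_nonneg hC0 K.2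
      calc δ * Real.exp (D * (t - 0)) ≤ Real.exp (-D) * Real.exp D := by
            refine mul_le_mul (min_le_right _ _) (Real.exp_le_exp.2 ?_) (Real.exp_pos _).le
              (Real.exp_pos _).le
            nlinarith [ht.2]
        _ = 1 := by rw [← Real.exp_add]; simp
    have h3 : |x t| ≤ B := hB t ht
    rw [Real.dist_eq] at h2
    have := abs_sub_abs_le_abs_sub (y t) (x t)
    linarith
  have hyper : IsPeriodicSol S y :=
    ⟨fun t ht => by rw [hS, ← hQP _ (hyB t ht)]; exact hy t ht, by rw [hy0, hy1]⟩
  have := hiso y hyper (by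
    rw [hy0, add_sub_cancel_left, abs_of_pos hδ]
    exact (min_le_left _ _).trans_lt (by linarith))
  linarith

lemma nodal_mul_sum_nodalWeight {m : ℕ} (hm : 1 ≤ m) {κ : ℕ → ℝ}
    (hκ : Set.InjOn κ (Finset.Icc 1 m)) {x : ℝ} (hx : ∀ i ∈ Finset.Icc 1 m, x ≠ κ i) :
    (Lagrange.nodal (Finset.Icc 1 m) κ).eval x *
      ∑ i ∈ Finset.Icc 1 m, Lagrange.nodalWeight (Finset.Icc 1 m) κ i * (x - κ i)⁻¹ = 1 := by
  have h := Lagrange.eval_interpolate_not_at_node (1 : ℕ → ℝ) hx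
  rw [Lagrange.interpolate_one hκ (Finset.nonempty_Icc.2 hm)] at h
  simpa using h.symm

/-- The primitive of the reciprocal of the nodal polynomial along a periodic solution. -/
lemma IsPeriodicSol.hasDerivWithinAt_sum_log {m : ℕ} (hm : 1 ≤ m) {d : ℕ → ℝ → ℝ}
    {S : ℝ → ℝ → ℝ} (hS : ∀ x t, S x t = ∑ i ∈ Finset.range (m + 1), d i t * x ^ i)
    {κ : ℕ → ℝ} (hκ : Set.InjOn κ (Finset.Icc 1 m)) {x : ℝ → ℝ} (hx : IsPeriodicSol S x)
    {t : ℝ} (ht : t ∈ Icc (0:ℝ) 1) (hne : ∀ i ∈ Finset.Icc 1 m, x t ≠ κ i) :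
    HasDerivWithinAt
      (fun t => ∑ i ∈ Finset.Icc 1 m,
        Lagrange.nodalWeight (Finset.Icc 1 m) κ i * Real.log (x t - κ i))
      (d m t + ∑ i ∈ Finset.Icc 1 m,
        Lagrange.nodalWeight (Finset.Icc 1 m) κ i * (x t - κ i)⁻¹ * S (κ i) t) (Icc 0 1) t := by
  have h := HasDerivWithinAt.fun_sum fun i (hi : i ∈ Finset.Icc 1 m) =>
    ((((hx.1 t ht).sub_const (κ i)).log (sub_ne_zero.2 (hne i hi))).const_mul
      (Lagrange.nodalWeight (Finset.Icc 1 m) κ i))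
  refine h.congr_deriv ?_
  have h1 := nodal_mul_sum_nodalWeight hm hκ hne
  have h2 := sum_eq_nodal_mul hκ (fun i => d i t) hne
  simp only [← hS] at h2
  have h3 : ∑ i ∈ Finset.Icc 1 m, Lagrange.nodalWeight (Finset.Icc 1 m) κ i *
      (S (x t) t / (x t - κ i)) = S (x t) t *
      ∑ i ∈ Finset.Icc 1 m, Lagrange.nodalWeight (Finset.Icc 1 m) κ i * (x t - κ i)⁻¹ := by
    rw [Finset.mul_sum]
    exact Finset.sum_congr rfl fun i _ => by rw [div_eq_mul_inv]; ring
  rw [h3, h2]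
  linear_combination (d m t + ∑ i ∈ Finset.Icc 1 m,
        Lagrange.nodalWeight (Finset.Icc 1 m) κ i * (x t - κ i)⁻¹ * S (κ i) t) * h1

/-- If two periodic solutions avoid the nodes and lie on consistently the same (or consistently
opposite) sides of those nodes that are not equilibria, then all nodes are equilibria. -/
lemma IsPeriodicSol.node_eq_zero {m : ℕ} (hm : 1 ≤ m) {d : ℕ → ℝ → ℝ}
    (hd : ∀ i, Continuous (d i)) {S : ℝ → ℝ → ℝ}
    (hS : ∀ x t, S x t = ∑ i ∈ Finset.range (m + 1), d i t * x ^ i)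
    {κ : ℕ → ℝ} (hκ : Set.InjOn κ (Finset.Icc 1 m)) {ρ : ℝ}
    (hρ : ∀ i ∈ Finset.Icc 1 m, ∀ t,
      0 ≤ ρ * (Lagrange.nodalWeight (Finset.Icc 1 m) κ i * S (κ i) t))
    (hρ0 : ρ ≠ 0) {x y : ℝ → ℝ} (hx : IsPeriodicSol S x) (hy : IsPeriodicSol S y)
    (hxκ : ∀ i ∈ Finset.Icc 1 m, ∀ t ∈ Icc (0:ℝ) 1, x t ≠ κ i)
    (hyκ : ∀ i ∈ Finset.Icc 1 m, ∀ t ∈ Icc (0:ℝ) 1, y t ≠ κ i) (hxy : x 0 < y 0) {σ : ℝ}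
    (hσ : ∀ i ∈ Finset.Icc 1 m, (∀ t ∈ Icc (0:ℝ) 1, S (κ i) t = 0) ∨
      0 < σ * ((x 0 - κ i) * (y 0 - κ i))) :
    ∀ i ∈ Finset.Icc 1 m, ∀ t ∈ Icc (0:ℝ) 1, S (κ i) t = 0 := by
  intro i₀ hi₀ t₀ ht₀
  rcases hσ i₀ hi₀ with h | hσ₀
  · exact h t₀ ht₀
  have hσ0 : σ ≠ 0 := by rintro rfl; simp at hσ₀
  have hne : ∀ t ∈ Icc (0:ℝ) 1, y t - x t ≠ 0 := fun t ht h => by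
    have := (hx.eq_of_touch hd hS (q := fun t => S (y t) t) hy.1 hy.2 one_ne_zero (by simp) ht
      (sub_eq_zero.1 h).symm).1
    exact hxy.ne this
  have hlt : ∀ t ∈ Icc (0:ℝ) 1, 0 < y t - x t := fun t ht =>
    pos_of_mul_pos_right (mul_pos_of_continuousOn_ne_zero
      (hy.continuousOn.sub hx.continuousOn) hne ht) (sub_pos.2 hxy).le
  set w := Lagrange.nodalWeight (Finset.Icc 1 m) κ
  have hside : ∀ {z : ℝ → ℝ}, IsPeriodicSol S z →
      (∀ i ∈ Finset.Icc 1 m, ∀ t ∈ Icc (0:ℝ) 1, z t ≠ κ i) →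
      ∀ i ∈ Finset.Icc 1 m, ∀ t ∈ Icc (0:ℝ) 1, 0 < (z 0 - κ i) * (z t - κ i) :=
    fun hz hzκ i hi t ht => mul_pos_of_continuousOn_ne_zero
      (hz.continuousOn.sub continuousOn_const) (fun s hs => sub_ne_zero.2 (hzκ i hi s hs)) ht
  have hterm : ∀ i ∈ Finset.Icc 1 m, ∀ t ∈ Icc (0:ℝ) 1,
      0 ≤ ρ * σ * (w i * (x t - κ i)⁻¹ * S (κ i) t - w i * (y t - κ i)⁻¹ * S (κ i) t) ∧
      (0 < σ * ((x 0 - κ i) * (y 0 - κ i)) →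
        w i * (x t - κ i)⁻¹ * S (κ i) t - w i * (y t - κ i)⁻¹ * S (κ i) t = 0 →
        S (κ i) t = 0) := by
    intro i hi t ht
    have hX := sub_ne_zero.2 (hxκ i hi t ht)
    have hY := sub_ne_zero.2 (hyκ i hi t ht)
    have hkey : w i * (x t - κ i)⁻¹ * S (κ i) t - w i * (y t - κ i)⁻¹ * S (κ i) t =
        w i * S (κ i) t * ((y t - x t) / ((x t - κ i) * (y t - κ i))) := by
      field_simp; ring
    rw [hkey]
    constructor
    · rcases hσ i hi with h | h
      · rw [h t ht]; simp
      · have hprod : 0 < σ * ((x t - κ i) * (y t - κ i)) := by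
          have h1 := mul_pos (hside hx hxκ i hi t ht) (hside hy hyκ i hi t ht)
          have h2 : 0 < (σ * ((x t - κ i) * (y t - κ i))) *
              (σ * ((x 0 - κ i) * (y 0 - κ i))) := by
            have := mul_pos (pow_pos (abs_pos.2 hσ0) 2) h1
            rw [sq_abs] at this
            nlinarith
          exact pos_of_mul_pos_left h2 h.le
        have h3 : 0 ≤ σ * ((y t - x t) / ((x t - κ i) * (y t - κ i))) := by
          have : σ * ((y t - x t) / ((x t - κ i) * (y t - κ i))) =
              σ ^ 2 * (y t - x t) / (σ * ((x t - κ i) * (y t - κ i))) := by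
            field_simp
          rw [this]
          exact div_nonneg (mul_nonneg (sq_nonneg _) (hlt t ht).le) hprod.le
        have := mul_nonneg (hρ i hi t) h3
        linarith
    · intro _ h
      have h4 : (y t - x t) / ((x t - κ i) * (y t - κ i)) ≠ 0 :=
        div_ne_zero (hlt t ht).ne' (mul_ne_zero hX hY)
      exact (mul_eq_zero.1 ((mul_eq_zero.1 h).resolve_right h4)).resolve_left
        (Lagrange.nodalWeight_ne_zero hκ hi)
  set H : (ℝ → ℝ) → ℝ → ℝ := fun z t => ∑ i ∈ Finset.Icc 1 m, w i * Real.log (z t - κ i)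
  have hzero := (eq_zero_of_periodic_linear (g := fun _ => 0) (t₀ := 0)
    (u := fun t => ρ * σ * ((H x t - H y t) - (H x 0 - H y 0)))
    (p := fun t => ρ * σ * ∑ i ∈ Finset.Icc 1 m,
      (w i * (x t - κ i)⁻¹ * S (κ i) t - w i * (y t - κ i)⁻¹ * S (κ i) t)) continuousOn_const
    (fun t ht => by
      rw [Finset.mul_sum]; exact Finset.sum_nonneg fun i hi => (hterm i hi t ht).1)
    (fun t ht => by
      have h1 := hx.hasDerivWithinAt_sum_log hm hS hκ ht fun i hi => hxκ i hi t ht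
      have h2 := hy.hasDerivWithinAt_sum_log hm hS hκ ht fun i hi => hyκ i hi t ht
      refine (((h1.sub h2).sub_const _).const_mul (ρ * σ)).congr_deriv ?_
      rw [Finset.sum_sub_distrib]; ring)
    (by simp only [H, hx.2, hy.2]) (left_mem_Icc.2 zero_le_one) (by simp)).2 t₀ ht₀
  simp only [Finset.mul_sum] at hzero
  have := (Finset.sum_eq_zero_iff_of_nonneg fun i hi => (hterm i hi t₀ ht₀).1).1 hzero i₀ hi₀
  exact (hterm i₀ hi₀ t₀ ht₀).2 hσ₀ ((mul_eq_zero.1 this).resolve_left (mul_ne_zero hρ0 hσ0))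

/-- Corollary 1.2: under Condition (C), the trigonometric generalized Abel equation (28)
has at most `m` isolated periodic solutions. -/
theorem trig_abel_C_at_most_m (m : ℕ) (hm : 1 ≤ m) (a b c : ℕ → ℝ)
    (S : ℝ → ℝ → ℝ)
    (hS : ∀ x t, S x t = ∑ i ∈ Finset.range (m + 1),
      (a i + b i * Real.cos (2 * Real.pi * t) + c i * Real.sin (2 * Real.pi * t)) * x ^ i)
    (fa fb fc : ℝ → ℝ)
    (hfa : ∀ x, fa x = ∑ i ∈ Finset.range (m + 1), a i * x ^ i)
    (hfb : ∀ x, fb x = ∑ i ∈ Finset.range (m + 1), b i * x ^ i)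
    (hfc : ∀ x, fc x = ∑ i ∈ Finset.range (m + 1), c i * x ^ i)
    (hC : CondC m fa fb fc) :
    ∃ F : Finset ℝ, F.card ≤ m ∧
      {x0 : ℝ | ∃ x : ℝ → ℝ, IsIsolatedPeriodicSol S x ∧ x 0 = x0} ⊆ (F : Set ℝ) := by
  obtain ⟨κ, hlt, hz, hsign⟩ := hC
  set s := Finset.Icc 1 m with hs
  set d : ℕ → ℝ → ℝ := fun i t =>
    a i + b i * Real.cos (2 * Real.pi * t) + c i * Real.sin (2 * Real.pi * t) with hd_def
  have hd : ∀ i, Continuous (d i) := fun i => by fun_prop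
  have hSd : ∀ x t, S x t = ∑ i ∈ Finset.range (m + 1), d i t * x ^ i := hS
  have hκ : Set.InjOn κ s := by
    intro i hi j hj hij
    rw [Finset.mem_coe, Finset.mem_Icc] at hi hj
    rcases lt_trichotomy i j with h | h | h
    · exact absurd hij (hlt i j hi.1 h hj.2).ne
    · exact h
    · exact absurd hij (hlt j i hj.1 h hi.2).ne'
  have hSf : ∀ x t, S x t =
      fa x + (fb x * Real.cos (2 * Real.pi * t) + fc x * Real.sin (2 * Real.pi * t)) := by
    intro x t
    rw [hS, hfa, hfb, hfc, Finset.sum_mul, Finset.sum_mul, ← Finset.sum_add_distrib,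
      ← Finset.sum_add_distrib]
    exact Finset.sum_congr rfl fun i _ => by ring
  have hfS : ∀ i ∈ s, ∀ t, 0 ≤ fa (κ i) * S (κ i) t := by
    intro i hi t
    rw [Finset.mem_Icc] at hi
    rw [hSf]
    set v := fb (κ i) * Real.cos (2 * Real.pi * t) + fc (κ i) * Real.sin (2 * Real.pi * t)
    have hv : v ^ 2 ≤ fa (κ i) ^ 2 := by
      have h1 := hz i hi.1 hi.2
      have h2 := Real.sin_sq_add_cos_sq (2 * Real.pi * t)
      have h3 := sq_nonneg (fb (κ i) * Real.sin (2 * Real.pi * t) -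
        fc (κ i) * Real.cos (2 * Real.pi * t))
      have h4 : v ^ 2 + (fb (κ i) * Real.sin (2 * Real.pi * t) -
          fc (κ i) * Real.cos (2 * Real.pi * t)) ^ 2 = fb (κ i) ^ 2 + fc (κ i) ^ 2 := by
        simp only [v]
        linear_combination (fb (κ i) ^ 2 + fc (κ i) ^ 2) * h2
      linarith
    nlinarith [sq_nonneg (fa (κ i) + v)]
  have hS0 : ∀ i ∈ s, fa (κ i) = 0 → ∀ t, S (κ i) t = 0 := by
    intro i hi h t
    rw [Finset.mem_Icc] at hi
    have h1 := hz i hi.1 hi.2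
    rw [h] at h1
    have hb0 : fb (κ i) = 0 := by nlinarith [sq_nonneg (fb (κ i)), sq_nonneg (fc (κ i))]
    have hc0 : fc (κ i) = 0 := by nlinarith [sq_nonneg (fb (κ i)), sq_nonneg (fc (κ i))]
    rw [hSf, h, hb0, hc0]; ring
  have hfa0 : ∀ z, (∀ t ∈ Icc (0:ℝ) 1, S z t = 0) → fa z = 0 := by
    intro z h
    have h0 := h 0 (by norm_num)
    have h1 := h (1 / 2) (by norm_num)
    rw [hSf] at h0 h1
    rw [show 2 * Real.pi * (1 / 2) = Real.pi by ring, Real.cos_pi, Real.sin_pi] at h1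
    rw [mul_zero, Real.cos_zero, Real.sin_zero] at h0
    linarith
  have hρ : ∃ ρ : ℝ, ρ ≠ 0 ∧ ∀ i ∈ s, ∀ t, 0 ≤ ρ * (Lagrange.nodalWeight s κ i * S (κ i) t) := by
    obtain ⟨η, hη0, hη⟩ : ∃ η : ℝ, η ≠ 0 ∧
        ∀ i, 1 ≤ i → i ≤ m → 0 ≤ η * (-1:ℝ) ^ i * fa (κ i) := by
      rcases hsign with h | h
      · exact ⟨1, one_ne_zero, fun i h1 h2 => by linarith [h i h1 h2]⟩
      · exact ⟨-1, by norm_num, fun i h1 h2 => by linarith [h i h1 h2]⟩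
    refine ⟨η * (-1) ^ m, mul_ne_zero hη0 (pow_ne_zero _ (by norm_num)), fun i hi t => ?_⟩
    have h1 := nodalWeight_sign hlt hi
    have hi' := Finset.mem_Icc.1 hi
    have h2 : 0 ≤ η * (-1:ℝ) ^ i * S (κ i) t := by
      by_cases hf : fa (κ i) = 0
      · rw [hS0 i hi hf]; simp
      · have h3 := mul_nonneg (hη i hi'.1 hi'.2) (hfS i hi t)
        refine nonneg_of_mul_nonneg_left (b := fa (κ i) ^ 2) ?_ (by positivity)
        linarith
    have h4 : (-1:ℝ) ^ i * (-1:ℝ) ^ i = 1 := by rw [← mul_pow]; simp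
    have h5 := mul_nonneg h1.le h2
    have h6 : η * (-1) ^ m * (Lagrange.nodalWeight s κ i * S (κ i) t) =
        (-1:ℝ) ^ m * (-1:ℝ) ^ i * Lagrange.nodalWeight s κ i * (η * (-1:ℝ) ^ i * S (κ i) t) := by
      linear_combination (-(η * (-1) ^ m * (Lagrange.nodalWeight s κ i * S (κ i) t))) * h4
    rw [h6]; exact h5
  obtain ⟨ρ, hρ0, hρ⟩ := hρ
  have htouch : ∀ x, IsPeriodicSol S x → ∀ i ∈ s, ∀ t ∈ Icc (0:ℝ) 1, x t = κ i →
      x 0 = κ i ∧ fa (κ i) = 0 := by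
    intro x hx i hi t ht hxt
    obtain ⟨σ, hσ0, hσ⟩ : ∃ σ : ℝ, σ ≠ 0 ∧ ∀ t ∈ Icc (0:ℝ) 1, 0 ≤ σ * (S (κ i) t - 0) := by
      by_cases hf : fa (κ i) = 0
      · exact ⟨1, one_ne_zero, fun t _ => by rw [hS0 i hi hf]; simp⟩
      · exact ⟨fa (κ i), hf, fun t _ => by rw [sub_zero]; exact hfS i hi t⟩
    have h := hx.eq_of_touch hd hS (y := fun _ => κ i) (q := fun _ => 0)
      (fun t _ => hasDerivWithinAt_const t _ _) rfl hσ0 hσ ht hxt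
    exact ⟨h.1, hfa0 _ h.2⟩
  have havoid : ∀ x, IsPeriodicSol S x → (∀ i ∈ s, fa (κ i) = 0 → x 0 ≠ κ i) →
      ∀ i ∈ s, ∀ t ∈ Icc (0:ℝ) 1, x t ≠ κ i := fun x hx h i hi t ht hxt =>
    have h' := htouch x hx i hi t ht hxt
    h i hi h'.2 h'.1
  set Λ : ℝ → ℝ := fun t => (b m * Real.sin (2 * Real.pi * t) +
    c m * (1 - Real.cos (2 * Real.pi * t))) / (2 * Real.pi)
  have hΛ : ∀ t, HasDerivAt Λ (d m t - a m) t := fun t => by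
    have hlin : HasDerivAt (fun t : ℝ => 2 * Real.pi * t) (2 * Real.pi) t := by
      simpa using (hasDerivAt_id t).const_mul (2 * Real.pi)
    have := ((hlin.sin.const_mul (b m)).add
      ((hlin.cos.const_sub 1).const_mul (c m))).div_const (2 * Real.pi)
    refine this.congr_deriv ?_
    simp only [hd_def]
    field_simp
    ring
  have hΛ0 : Λ 0 = 0 := by simp [Λ]
  have hΛ1 : Λ 1 = 0 := by simp [Λ]
  by_cases hall : ∀ i ∈ s, fa (κ i) = 0
  · by_cases ham : a m = 0
    · refine ⟨∅, by simp, ?_⟩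
      rintro _ ⟨x, hx, rfl⟩
      refine absurd hx (not_isIsolatedPeriodicSol_of_separable (l := d m) (Λ := Λ)
        (P := fun z => (Lagrange.nodal s κ).eval z) (by
          simpa only [Polynomial.coe_aeval_eq_eval] using
            (Lagrange.nodal s κ).contDiff_aeval (𝕜 := ℝ) 1)
        (hd m) (fun t => ?_) hΛ0 hΛ1 (fun z t => ?_) x)
      · simpa [ham] using hΛ t
      · by_cases hzκ : ∀ i ∈ s, z ≠ κ i
        · have h := sum_eq_nodal_mul hκ (fun i => d i t) hzκ
          rw [hSd, h, Finset.sum_eq_zero fun i hi => ?_, add_zero, mul_comm]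
          have := hS0 i hi (hall i hi) t
          rw [hSd] at this
          rw [this, mul_zero]
        · push Not at hzκ
          obtain ⟨i, hi, rfl⟩ := hzκ
          rw [hS0 i hi (hall i hi) t, Lagrange.eval_nodal_at_node hi, mul_zero]
    · refine ⟨s.image κ, Finset.card_image_le.trans (by simp [hs]), ?_⟩
      rintro _ ⟨x, ⟨hx, -⟩, rfl⟩
      by_contra hx0
      have hx0' : ∀ i ∈ s, fa (κ i) = 0 → x 0 ≠ κ i := fun i hi _ h =>
        hx0 (Finset.mem_coe.2 (Finset.mem_image.2 ⟨i, hi, h.symm⟩))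
      have hne := havoid x hx hx0'
      set H : ℝ → ℝ := fun t => ∑ i ∈ s, Lagrange.nodalWeight s κ i * Real.log (x t - κ i)
      have := (eq_zero_of_periodic_linear (g := fun _ => 0) (t₀ := 0)
        (u := fun t => a m * (H t - H 0 - Λ t)) (p := fun _ => a m ^ 2) continuousOn_const
        (fun _ _ => sq_nonneg _)
        (fun t ht => by
          have h1 := hx.hasDerivWithinAt_sum_log hm hS hκ ht fun i hi => hne i hi t ht
          refine (((h1.sub_const _).sub (hΛ t).hasDerivWithinAt).const_mul (a m)).congr_deriv ?_
          rw [Finset.sum_eq_zero fun i hi => by rw [hS0 i hi (hall i hi) t, mul_zero]]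
          ring)
        (by simp only [H, hx.2, hΛ0, hΛ1]) (left_mem_Icc.2 zero_le_one)
        (by simp [hΛ0])).2 0 (left_mem_Icc.2 zero_le_one)
      exact ham (pow_eq_zero_iff two_ne_zero |>.1 this)
  · set N := s.filter fun i => ¬ fa (κ i) = 0 with hN
    set X : Set ℝ := {x0 | ∃ x, IsPeriodicSol S x ∧ x 0 = x0 ∧
      ∀ i ∈ s, fa (κ i) = 0 → x 0 ≠ κ i}
    set below : ℝ → Finset ℕ := fun x0 => N.filter fun i => κ i < x0
    have hNpos : 0 < N.card := by
      push Not at hall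
      obtain ⟨i, hi, h⟩ := hall
      exact Finset.card_pos.2 ⟨i, Finset.mem_filter.2 ⟨hi, h⟩⟩
    have hpair : ∀ x0 ∈ X, ∀ y0 ∈ X, x0 < y0 →
        (below x0).card % N.card ≠ (below y0).card % N.card := by
      rintro _ ⟨x, hx, rfl, hx0⟩ _ ⟨y, hy, rfl, hy0⟩ hxy hmod
      have hxne := havoid x hx hx0
      have hyne := havoid y hy hy0
      have hz0 : (0:ℝ) ∈ Icc (0:ℝ) 1 := left_mem_Icc.2 zero_le_one
      have key : ∀ σ : ℝ, (∀ i ∈ N, 0 < σ * ((x 0 - κ i) * (y 0 - κ i))) → False := by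
        intro σ hσ
        refine hall fun i hi => hfa0 _ (hx.node_eq_zero hm hd hS hκ hρ hρ0 hy hxne hyne hxy
          (σ := σ) (fun j hj => ?_) i hi)
        by_cases hf : fa (κ j) = 0
        · exact Or.inl fun t _ => hS0 j hj hf t
        · exact Or.inr (hσ j (Finset.mem_filter.2 ⟨hj, hf⟩))
      have hsub : below (x 0) ⊆ below (y 0) :=
        Finset.monotone_filter_right _ fun i _ h => lt_trans h hxy
      have hle := Finset.card_le_card hsub
      have hyN : (below (y 0)).card ≤ N.card := Finset.card_le_card (Finset.filter_subset _ _)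
      rcases hle.eq_or_lt with heq | hlt'
      · have hset := Finset.eq_of_subset_of_card_le hsub heq.ge
        refine key 1 fun i hi => ?_
        have his := (Finset.mem_filter.1 hi).1
        rw [one_mul]
        rcases lt_or_gt_of_ne (hxne i his 0 hz0) with h | h
        · have hnot : ¬ κ i < y 0 := fun h' => by
            have : i ∈ below (x 0) := by rw [hset]; exact Finset.mem_filter.2 ⟨hi, h'⟩
            exact absurd (Finset.mem_filter.1 this).2 (not_lt.2 h.le)
          have h2 := lt_of_le_of_ne (not_lt.1 hnot) (hyne i his 0 hz0)
          exact mul_pos_of_neg_of_neg (sub_neg.2 h) (sub_neg.2 h2)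
        · exact mul_pos (sub_pos.2 h) (sub_pos.2 (h.trans hxy))
      · have hyc : (below (y 0)).card = N.card := by
          by_contra hne'
          rw [Nat.mod_eq_of_lt (lt_of_le_of_ne hyN hne'), Nat.mod_eq_of_lt (hlt'.trans_le hyN)]
            at hmod
          exact hlt'.ne hmod
        have hxc : (below (x 0)).card = 0 := by
          rw [hyc, Nat.mod_self, Nat.mod_eq_of_lt (hlt'.trans_le hyN)] at hmod
          exact hmod
        have hyset : below (y 0) = N := Finset.eq_of_subset_of_card_le (Finset.filter_subset _ _) hyc.ge
        refine key (-1) fun i hi => ?_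
        have his := (Finset.mem_filter.1 hi).1
        have hyi : κ i < y 0 := by
          have : i ∈ below (y 0) := by rw [hyset]; exact hi
          exact (Finset.mem_filter.1 this).2
        have hxi : x 0 < κ i := by
          refine lt_of_le_of_ne (not_lt.1 fun h => ?_) (hxne i his 0 hz0)
          have : i ∈ below (x 0) := Finset.mem_filter.2 ⟨hi, h⟩
          rw [Finset.card_eq_zero.1 hxc] at this
          simp at this
        have := mul_neg_of_neg_of_pos (sub_neg.2 hxi) (sub_pos.2 hyi)
        linarith
    have hinj : InjOn (fun x0 => (below x0).card % N.card) X := by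
      intro x0 hx0 y0 hy0 h
      rcases lt_trichotomy x0 y0 with h' | h' | h'
      · exact absurd h (hpair x0 hx0 y0 hy0 h')
      · exact h'
      · exact absurd h.symm (hpair y0 hy0 x0 hx0 h')
    have hmaps : MapsTo (fun x0 => (below x0).card % N.card) X (Finset.range N.card : Set ℕ) :=
      fun x0 _ => Finset.mem_coe.2 (Finset.mem_range.2 (Nat.mod_lt _ hNpos))
    have hfin : X.Finite := Set.Finite.of_injOn hmaps hinj (Finset.finite_toSet _)
    have hXcard : hfin.toFinset.card ≤ N.card := by
      have := Finset.card_le_card_of_injOn (s := hfin.toFinset) (t := Finset.range N.card)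
        (fun x0 => (below x0).card % N.card)
        (by rw [Set.Finite.coe_toFinset]; exact hmaps)
        (by rw [Set.Finite.coe_toFinset]; exact hinj)
      rwa [Finset.card_range] at this
    refine ⟨(s.filter fun i => fa (κ i) = 0).image κ ∪ hfin.toFinset, ?_, ?_⟩
    · refine (Finset.card_union_le _ _).trans
        ((add_le_add Finset.card_image_le hXcard).trans_eq ?_)
      rw [hN, Finset.card_filter_add_card_filter_not]
      simp [hs]
    · rintro _ ⟨x, ⟨hx, -⟩, rfl⟩
      rw [Finset.mem_coe, Finset.mem_union, Finset.mem_image, Set.Finite.mem_toFinset]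
      by_cases h : ∀ i ∈ s, fa (κ i) = 0 → x 0 ≠ κ i
      · exact Or.inr ⟨x, hx, rfl, h⟩
      · push Not at h
        obtain ⟨i, hi, hf, hxi⟩ := h
        exact Or.inl ⟨i, Finset.mem_filter.2 ⟨hi, hf⟩, hxi.symm⟩
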